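/- arXiv:1304.7332 — 3 statements merged into one kernel-verified Lean document; each statement's English description precedes it below -/
import Mathlib

section
/- A noetherian local ring (A, m) is almost Cohen-Macaulay if and only if dim(A) ≤ 1 + depth(A). -/
open IsLocalRing

/-- The `I`-depth (grade) of an `A`-module `M`: the supremum of lengths of
`M`-regular sequences with entries in `I`. -/
noncomputable def idealDepth {A : Type*} [CommRing A] (I : Ideal A)
    (M : Type*) [AddCommGroup M] [Module A M] : ℕ∞ :=
  sSup {n : ℕ∞ | ∃ rs : List A, (rs.length : ℕ∞) = n ∧ (∀ r ∈ rs, r ∈ I) ∧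
    RingTheory.Sequence.IsRegular M rs}

/-- The depth of a local ring: the depth with respect to its maximal ideal. -/
noncomputable def ringDepth (A : Type*) [CommRing A] [IsLocalRing A] : ℕ∞ :=
  idealDepth (IsLocalRing.maximalIdeal A) A

/-- depth(A_P), the depth of the localization of `A` at the prime `P`. -/
noncomputable def localDepth {A : Type*} [CommRing A] (P : Ideal A) [P.IsPrime] : ℕ∞ :=
  ringDepth (Localization.AtPrime P)

/-- The height of a prime ideal. -/
noncomputable def primeHeight {A : Type*} [CommRing A] (P : Ideal A) [P.IsPrime] : ℕ∞ :=
  Order.height (⟨P, inferInstance⟩ : PrimeSpectrum A)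

/-- A noetherian local ring is almost Cohen-Macaulay if `dim A ≤ 1 + depth A`. -/
def IsAlmostCM (A : Type*) [CommRing A] [IsLocalRing A] : Prop :=
  ringKrullDim A ≤ ((1 + ringDepth A : ℕ∞) : WithBot ℕ∞)

/-- Almost Cohen-Macaulay for a (local) ring presented with an explicit maximal ideal `I`:
`dim R ≤ 1 + depth_I R`. -/
def IsAlmostCMWith (R : Type*) [CommRing R] (I : Ideal R) : Prop :=
  ringKrullDim R ≤ ((1 + idealDepth I R : ℕ∞) : WithBot ℕ∞)

/-- A ring is almost Cohen-Macaulay (Han/Kang) if `depth_P A = depth (A_P)` for all primes. -/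
def IsACM (A : Type*) [CommRing A] : Prop :=
  ∀ (P : Ideal A) [P.IsPrime], idealDepth P A = localDepth P

/-- Serre's condition `(S_k)`: `depth A_P ≥ min (ht P, k)` for all primes `P`. -/
def SerreCond (k : ℕ) (A : Type*) [CommRing A] : Prop :=
  ∀ (P : Ideal A) [P.IsPrime], min (primeHeight P) (k : ℕ∞) ≤ localDepth P

/-- The condition `(C_k)`: `depth A_P ≥ min (ht P, k) - 1` for all primes `P`. -/
def CondC (k : ℕ) (A : Type*) [CommRing A] : Prop :=
  ∀ (P : Ideal A) [P.IsPrime], min (primeHeight P) (k : ℕ∞) ≤ 1 + localDepth P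

open RingTheory.Sequence CategoryTheory Abelian Pointwise

universe u

lemma idealDepth_mono {A : Type*} [CommRing A] {I J : Ideal A} (h : I ≤ J) (M : Type*)
    [AddCommGroup M] [Module A M] : idealDepth I M ≤ idealDepth J M :=
  sSup_le_sSup fun _ ⟨rs, hn, hmem, hreg⟩ ↦ ⟨rs, hn, fun r hr ↦ h (hmem r hr), hreg⟩

lemma length_le_idealDepth {A M : Type*} [CommRing A] [AddCommGroup M] [Module A M]
    {I : Ideal A} {rs : List A} (hmem : ∀ r ∈ rs, r ∈ I) (hreg : IsRegular M rs) :
    (rs.length : ℕ∞) ≤ idealDepth I M :=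
  le_sSup ⟨rs, rfl, hmem, hreg⟩

lemma isRegular_append_singleton {R M : Type*} [CommRing R] [IsLocalRing R]
    [AddCommGroup M] [Module R M] [Module.Finite R M] [Nontrivial M] {xs : List R}
    (hxs_mem : ∀ r ∈ xs, r ∈ maximalIdeal R) (hxs : IsRegular M xs) {y : R} (hy : y ∈ maximalIdeal R)
    (hreg : IsSMulRegular (M ⧸ (Ideal.ofList xs • ⊤ : Submodule R M)) y) :
    IsRegular M (xs ++ [y]) := by
  refine IsRegular.of_isWeaklyRegular_of_mem_maximalIdeal M ?_ ?_
  · simpa [or_imp, forall_and] using ⟨hxs_mem, hy⟩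
  · exact (isWeaklyRegular_append_iff M xs [y]).mpr
      ⟨hxs.toIsWeaklyRegular, (isWeaklyRegular_singleton_iff _ y).mpr hreg⟩

section Noetherian

variable {R : Type u} [CommRing R] [IsNoetherianRing R]

/-- An ideal consisting of zero-divisors on a finite module is contained in an associated prime. -/
lemma exists_mem_associatedPrimes_of_forall_not_isSMulRegular {M : Type*} [AddCommGroup M]
    [Module R M] [Module.Finite R M] [Nontrivial M] {I : Ideal R}
    (h : ∀ x ∈ I, ¬ IsSMulRegular M x) : ∃ Q ∈ associatedPrimes R M, I ≤ Q := by
  obtain ⟨Q₀, -⟩ := associatedPrimes.nonempty R M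
  refine (Ideal.subset_union_prime_finite (associatedPrimes.finite R M) (f := id) Q₀ Q₀
    fun Q hQ _ _ ↦ IsAssociatedPrime.isPrime hQ).mp ?_
  rw [show (⋃ Q ∈ associatedPrimes R M, ((id Q : Ideal R) : Set R)) = _ from
    biUnion_associatedPrimes_eq_compl_regular R M]
  exact h

lemma not_isSMulRegular_of_mem_associatedPrimes {M : Type*} [AddCommGroup M]
    [Module R M] {Q : Ideal R} (hQ : Q ∈ associatedPrimes R M) {x : R} (hx : x ∈ Q) :
    ¬ IsSMulRegular M x := by
  have : x ∈ ({r : R | IsSMulRegular M r}ᶜ : Set R) := by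
    rw [← biUnion_associatedPrimes_eq_compl_regular R M]
    exact Set.mem_biUnion hQ hx
  exact this

lemma ringKrullDim_le_one_of_finite_primeSpectrum [Finite (PrimeSpectrum R)] :
    ringKrullDim R ≤ 1 := by
  refine (ringKrullDim_le_iff_height_le 1).mpr fun p hp ↦ ?_
  obtain ⟨x, hxp, hx⟩ : ∃ x ∈ p, ∀ q : PrimeSpectrum R, ¬ p ≤ q.asIdeal → x ∉ q.asIdeal := by
    by_contra! h
    have hfin : {q : PrimeSpectrum R | ¬ p ≤ q.asIdeal}.Finite := Set.toFinite _
    obtain ⟨q, hq, hpq⟩ := (Ideal.subset_union_prime_finite hfin (f := PrimeSpectrum.asIdeal)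
      ⟨p, hp⟩ ⟨p, hp⟩ (fun q _ _ _ ↦ q.isPrime) (I := p)).mp fun x hx ↦ by
        obtain ⟨q, hq, hxq⟩ := h x hx
        exact Set.mem_biUnion hq hxq
    exact hq hpq
  have hmin : p ∈ (Ideal.span {x}).minimalPrimes := by
    refine ⟨⟨hp, (Ideal.span_singleton_le_iff_mem p).mpr hxp⟩, fun q ⟨hq, hxq⟩ _ ↦ ?_⟩
    by_contra hpq
    exact hx ⟨q, hq⟩ hpq (hxq (Ideal.mem_span_singleton_self x))
  exact_mod_cast Ideal.height_le_one_of_isPrincipal_of_mem_minimalPrimes _ p hmin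

/-- By Rees' theorem, the maximal length of a regular sequence in an ideal drops by at most one
after factoring out any regular element of the ideal. -/
lemma exists_isRegular_quotSMulTop {M : Type u} [AddCommGroup M] [Module R M] [Module.Finite R M]
    {I : Ideal R} (hI : I • (⊤ : Submodule R M) < ⊤) {x : R} (hx : x ∈ I)
    (hreg : IsSMulRegular M x) {n : ℕ}
    (h : ∃ rs : List R, rs.length = n + 1 ∧ (∀ r ∈ rs, r ∈ I) ∧ IsRegular M rs) :
    ∃ rs : List R, rs.length = n ∧ (∀ r ∈ rs, r ∈ I) ∧ IsRegular (QuotSMulTop x M) rs := by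
  have hI' : I • (⊤ : Submodule R (QuotSMulTop x M)) < ⊤ := by
    refine lt_top_iff_ne_top.mpr fun eq ↦ hI.ne ?_
    have := congrArg (Submodule.comap (Submodule.mkQ _)) eq
    simpa [Submodule.comap_smul_top_of_surjective I _ (Submodule.mkQ_surjective _),
      Submodule.smul_mono_left ((Ideal.span_singleton_le_iff_mem I).mpr hx),
      ← Submodule.ideal_span_singleton_smul] using this
  have hext := ((ModuleCat.exists_isRegular_tfae I (n + 1) (ModuleCat.of R M) hI).out 3 1).mp h
  refine ((ModuleCat.exists_isRegular_tfae I n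
    (ModuleCat.of R (QuotSMulTop x M)) hI').out 1 3).mp fun i hi ↦ ?_
  have zero1 := AddCommGrpCat.isZero_of_iff_subsingleton.mpr (hext i (by omega))
  have zero2 := AddCommGrpCat.isZero_of_iff_subsingleton.mpr (hext (i + 1) (by omega))
  have hreg' : IsSMulRegular (ModuleCat.of R M) x := hreg
  exact AddCommGrpCat.subsingleton_of_isZero <| ShortComplex.Exact.isZero_of_both_zeros
    ((Ext.covariant_sequence_exact₃' _ hreg'.smulShortComplex_shortExact) i (i + 1) rfl)
    (zero1.eq_zero_of_src _) (zero2.eq_zero_of_tgt _)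

end Noetherian

section Local

variable {R : Type u} [CommRing R] [IsNoetherianRing R] [IsLocalRing R]

lemma exists_lt_mem_associatedPrimes_quotSMulTop {M : Type*} [AddCommGroup M] [Module R M]
    [Module.Finite R M] {x : R} (hx : x ∈ maximalIdeal R) (hreg : IsSMulRegular M x)
    {Q : Ideal R} (hQ : Q ∈ associatedPrimes R M) :
    ∃ Q' ∈ associatedPrimes R (QuotSMulTop x M), Q < Q' := by
  have hxQ : x ∉ Q := fun h ↦ not_isSMulRegular_of_mem_associatedPrimes hQ h hreg
  obtain ⟨hprime, w, hw⟩ := isAssociatedPrime_iff.mp hQ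
  let U : Submodule R M := Submodule.torsionBySet R M Q
  have hwU : w ∈ U := by
    refine (Submodule.mem_torsionBySet_iff _ _).mpr fun a ↦ ?_
    have := hw.le a.2
    simpa [Submodule.mem_colon_singleton] using this
  have hw0 : w ≠ 0 := by
    rintro rfl
    exact hprime.ne_top (by simp [hw])
  obtain ⟨z, hzU, hz⟩ : ∃ z ∈ U, z ∉ x • (⊤ : Submodule R M) := by
    by_contra! h
    have hle : U ≤ Ideal.span {x} • U := fun z hz ↦ by
      obtain ⟨y, -, rfl⟩ := h z hz
      refine Submodule.smul_mem_smul (Ideal.mem_span_singleton_self x) ?_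
      refine (Submodule.mem_torsionBySet_iff _ _).mpr fun a ↦ hreg ?_
      have := (Submodule.mem_torsionBySet_iff _ _).mp hz a
      simpa [smul_comm x] using this
    have := Submodule.eq_bot_of_le_smul_of_le_jacobson_bot _ U (IsNoetherian.noetherian U) hle
      (((Ideal.span_singleton_le_iff_mem _).mpr hx).trans (maximalIdeal_le_jacobson _))
    rw [this] at hwU
    exact hw0 (by simpa using hwU)
  let zbar : QuotSMulTop x M := Submodule.Quotient.mk z
  have hzbar : zbar ≠ 0 := by simpa [zbar, Submodule.Quotient.mk_eq_zero] using hz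
  obtain ⟨Q', hQ', hle⟩ := exists_le_isAssociatedPrime_of_isNoetherianRing R zbar hzbar
  have hxQ' : x ∈ Q' := hle <| by
    rw [Submodule.mem_colon_singleton, Submodule.mem_bot, ← Submodule.Quotient.mk_smul,
      Submodule.Quotient.mk_eq_zero]
    exact Submodule.smul_mem_pointwise_smul _ _ _ trivial
  refine ⟨Q', hQ', lt_of_le_of_ne (fun a ha ↦ hle ?_) fun h ↦ hxQ (h ▸ hxQ')⟩
  rw [Submodule.mem_colon_singleton, Submodule.mem_bot, ← Submodule.Quotient.mk_smul,
    show a • z = 0 from (Submodule.mem_torsionBySet_iff _ _).mp hzU ⟨a, ha⟩,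
    Submodule.Quotient.mk_zero]

/-- The depth of a finite module is at most the dimension of the closed set defined by any of its
associated primes. -/
lemma length_le_coheight_of_mem_associatedPrimes {M : Type*} [AddCommGroup M] [Module R M]
    [Module.Finite R M] {rs : List R} (hmem : ∀ r ∈ rs, r ∈ maximalIdeal R)
    (hreg : IsRegular M rs) {Q : PrimeSpectrum R} (hQ : Q.asIdeal ∈ associatedPrimes R M) :
    (rs.length : ℕ∞) ≤ Order.coheight Q := by
  induction rs generalizing M Q with
  | nil => simp
  | cons x rs ih =>
    obtain ⟨hx, hrs⟩ := (isRegular_cons_iff M x rs).mp hreg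
    obtain ⟨Q', hQ', hlt⟩ := exists_lt_mem_associatedPrimes_quotSMulTop
      (hmem x List.mem_cons_self) hx hQ
    obtain ⟨Q', rfl⟩ : ∃ q : PrimeSpectrum R, q.asIdeal = Q' :=
      ⟨⟨Q', IsAssociatedPrime.isPrime hQ'⟩, rfl⟩
    calc ((x :: rs).length : ℕ∞) = rs.length + 1 := by simp
      _ ≤ Order.coheight Q' + 1 := by
        gcongr
        exact ih (fun r hr ↦ hmem r (List.mem_cons_of_mem _ hr)) hrs hQ'
      _ ≤ Order.coheight Q := Order.coheight_add_one_le hlt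

lemma length_le_length_add_coheight {M : Type u} [AddCommGroup M] [Module R M]
    [Module.Finite R M] {xs rs : List R} (hxs_mem : ∀ r ∈ xs, r ∈ maximalIdeal R)
    (hxs : IsRegular M xs) (hmem : ∀ r ∈ rs, r ∈ maximalIdeal R) (hreg : IsRegular M rs)
    {Q : PrimeSpectrum R}
    (hQ : Q.asIdeal ∈ associatedPrimes R (M ⧸ (Ideal.ofList xs • ⊤ : Submodule R M))) :
    (rs.length : ℕ∞) ≤ xs.length + Order.coheight Q := by
  induction xs generalizing M rs with
  | nil =>
    have e : (M ⧸ (Ideal.ofList ([] : List R) • ⊤ : Submodule R M)) ≃ₗ[R] M :=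
      Submodule.quotEquivOfEqBot _ (by rw [Ideal.ofList_nil, Submodule.bot_smul])
    rw [LinearEquiv.AssociatedPrimes.eq e] at hQ
    simpa using length_le_coheight_of_mem_associatedPrimes hmem hreg hQ
  | cons x xs ih =>
    obtain ⟨hx, hxs⟩ := (isRegular_cons_iff M x xs).mp hxs
    rw [LinearEquiv.AssociatedPrimes.eq
      (Submodule.quotOfListConsSMulTopEquivQuotSMulTopInner M x xs)] at hQ
    rcases hn : rs.length with _ | n
    · simp
    have := hreg.nontrivial
    have hI : maximalIdeal R • (⊤ : Submodule R M) < ⊤ := lt_top_iff_ne_top.mpr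
      (Submodule.top_ne_ideal_smul_of_le_jacobson_annihilator
        (maximalIdeal_le_jacobson _)).symm
    obtain ⟨rs', hlen, hmem', hreg'⟩ := exists_isRegular_quotSMulTop hI
      (hxs_mem x List.mem_cons_self) hx ⟨rs, hn, hmem, hreg⟩
    have := ih (fun r hr ↦ hxs_mem r (List.mem_cons_of_mem _ hr)) hxs hmem' hreg' hQ
    rw [hlen] at this
    calc ((n + 1 : ℕ) : ℕ∞) = n + 1 := by simp
      _ ≤ (xs.length + Order.coheight Q) + 1 := by gcongr
      _ = _ := by simp; ring

lemma idealDepth_le_ringKrullDim (I : Ideal R) :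
    (idealDepth I R : WithBot ℕ∞) ≤ ringKrullDim R := by
  obtain ⟨d, hd⟩ := WithBot.ne_bot_iff_exists.mp (ringKrullDim_ne_bot (R := R))
  rw [← hd, WithBot.coe_le_coe]
  refine sSup_le ?_
  rintro _ ⟨rs, rfl, -, hreg⟩
  have h := ringKrullDim_add_length_eq_ringKrullDim_of_isRegular rs hreg
  have : Nontrivial (R ⧸ Ideal.ofList rs) := by
    rw [Ideal.Quotient.nontrivial_iff]
    intro h
    exact hreg.top_ne_smul (by simp [h])
  rw [← WithBot.coe_le_coe, hd, ← h]
  exact le_add_of_nonneg_left ringKrullDim_nonneg_of_nontrivial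

lemma exists_isRegular_length_eq_idealDepth (I : Ideal R) :
    ∃ rs : List R, (rs.length : ℕ∞) = idealDepth I R ∧ (∀ r ∈ rs, r ∈ I) ∧ IsRegular R rs := by
  have : Nonempty {n : ℕ∞ | ∃ rs : List R, (rs.length : ℕ∞) = n ∧ (∀ r ∈ rs, r ∈ I) ∧
      IsRegular R rs} := ⟨0, [], by simp, by simp, IsRegular.nil R R⟩
  refine ENat.sSup_mem_of_nonempty_of_lt_top (s := {n : ℕ∞ | ∃ rs : List R,
    (rs.length : ℕ∞) = n ∧ (∀ r ∈ rs, r ∈ I) ∧ IsRegular R rs}) ?_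
  rw [← WithBot.coe_lt_coe]
  exact (idealDepth_le_ringKrullDim I).trans_lt ringKrullDim_lt_top

lemma exists_le_mem_associatedPrimes_of_length_eq_idealDepth {I : Ideal R}
    (hI : I ≤ maximalIdeal R) {xs : List R} (hlen : (xs.length : ℕ∞) = idealDepth I R)
    (hmem : ∀ r ∈ xs, r ∈ I) (hreg : IsRegular R xs) :
    ∃ Q ∈ associatedPrimes R (R ⧸ (Ideal.ofList xs • ⊤ : Submodule R R)), I ≤ Q := by
  have := hreg.quot_ofList_smul_nontrivial ⊤
  refine exists_mem_associatedPrimes_of_forall_not_isSMulRegular fun y hy hy' ↦ ?_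
  have h := length_le_idealDepth (I := I) (rs := xs ++ [y])
    (by simpa [or_imp, forall_and] using ⟨hmem, hy⟩)
    (isRegular_append_singleton (fun r hr ↦ hI (hmem r hr)) hreg (hI hy) hy')
  rw [← hlen] at h
  simp only [List.length_append, List.length_singleton, Nat.cast_le] at h
  omega

end Local

section Localization

variable {A : Type u} [CommRing A] (P : Ideal A) [P.IsPrime]

lemma isRegular_map_algebraMap_localization {xs : List A} (hmem : ∀ r ∈ xs, r ∈ P)
    (hreg : IsRegular A xs) :
    IsRegular (Localization.AtPrime P) (xs.map (algebraMap A (Localization.AtPrime P))) :=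
  hreg.toIsWeaklyRegular.isRegular_of_isLocalization_of_mem _ P hmem

lemma map_algebraMap_mem_maximalIdeal {xs : List A} (hmem : ∀ r ∈ xs, r ∈ P) :
    ∀ r ∈ xs.map (algebraMap A (Localization.AtPrime P)), r ∈ maximalIdeal _ := by
  intro r hr
  obtain ⟨a, ha, rfl⟩ := List.mem_map.mp hr
  exact (IsLocalization.AtPrime.to_map_mem_maximal_iff _ P a).mpr (hmem a ha)

lemma idealDepth_le_localDepth : idealDepth P A ≤ localDepth P := by
  refine sSup_le ?_
  rintro _ ⟨rs, rfl, hmem, hreg⟩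
  simpa only [List.length_map] using! length_le_idealDepth (map_algebraMap_mem_maximalIdeal P hmem)
    (isRegular_map_algebraMap_localization P hmem hreg)

lemma maximalIdeal_mem_associatedPrimes_localization_iff [IsNoetherianRing A] (xs : List A) :
    maximalIdeal (Localization.AtPrime P) ∈ associatedPrimes (Localization.AtPrime P)
      (Localization.AtPrime P ⧸ (Ideal.ofList (xs.map (algebraMap A (Localization.AtPrime P))) • ⊤ :
        Submodule (Localization.AtPrime P) (Localization.AtPrime P))) ↔
    P ∈ associatedPrimes A (A ⧸ (Ideal.ofList xs • ⊤ : Submodule A A)) := by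
  rw [← Ideal.map_ofList, ← Ideal.localized'_eq_map (Localization.AtPrime P) P.primeCompl,
    ← Submodule.localized'_top (Localization.AtPrime P) P.primeCompl
      (Algebra.linearMap A (Localization.AtPrime P)),
    ← Submodule.localized'_smul,
    ← Module.associatedPrimes.preimage_comap_associatedPrimes_eq_associatedPrimes_of_isLocalizedModule
      P.primeCompl (R' := Localization.AtPrime P)
      (Submodule.toLocalizedQuotient' (Localization.AtPrime P) P.primeCompl
        (Algebra.linearMap A (Localization.AtPrime P))
        (Ideal.ofList xs • ⊤ : Submodule A A)),
    Set.mem_preimage]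
  have : Ideal.comap (algebraMap A (Localization.AtPrime P)) (maximalIdeal _) = P :=
    Localization.AtPrime.under_maximalIdeal
  rw [this]

end Localization

section Main

variable {A : Type u} [CommRing A] [IsNoetherianRing A]

lemma localDepth_le_length_of_mem_associatedPrimes (P : Ideal A) [P.IsPrime] {xs : List A}
    (hmem : ∀ r ∈ xs, r ∈ P) (hreg : IsRegular A xs)
    (hP : P ∈ associatedPrimes A (A ⧸ (Ideal.ofList xs • ⊤ : Submodule A A))) :
    localDepth P ≤ xs.length := by
  refine sSup_le ?_
  rintro _ ⟨rs, rfl, hrs_mem, hrs⟩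
  have h := length_le_length_add_coheight (map_algebraMap_mem_maximalIdeal P hmem)
    (isRegular_map_algebraMap_localization P hmem hreg) hrs_mem hrs
    (Q := closedPoint (Localization.AtPrime P))
    ((maximalIdeal_mem_associatedPrimes_localization_iff P xs).mpr hP)
  have htop : IsMax (closedPoint (Localization.AtPrime P)) :=
    isMax_top
  rwa [Order.coheight_eq_zero.mpr htop, add_zero, List.length_map] at h

lemma localDepth_le_primeHeight (P : Ideal A) [P.IsPrime] : localDepth P ≤ primeHeight P := by
  have h := idealDepth_le_ringKrullDim (maximalIdeal (Localization.AtPrime P))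
  rw [IsLocalization.AtPrime.ringKrullDim_eq_height P, WithBot.coe_le_coe,
    PrimeSpectrum.height_eq_orderHeight ⟨P, inferInstance⟩] at h
  exact h

variable [IsLocalRing A]

lemma coheight_lt_top (P : PrimeSpectrum A) : Order.coheight P < ⊤ := by
  rw [← WithBot.coe_lt_coe]
  exact (Order.coheight_le_krullDim P).trans_lt ringKrullDim_lt_top

lemma idealDepth_eq_localDepth_of_ringKrullDim_le
    (h : ringKrullDim A ≤ ((1 + ringDepth A : ℕ∞) : WithBot ℕ∞)) (P : Ideal A) [P.IsPrime] :
    idealDepth P A = localDepth P := by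
  have hPm : P ≤ maximalIdeal A := le_maximalIdeal_of_isPrime P
  refine (idealDepth_le_localDepth P).antisymm ?_
  obtain ⟨xs, hlen, hmem, hreg⟩ := exists_isRegular_length_eq_idealDepth P
  obtain ⟨Q, hQ, hPQ⟩ :=
    exists_le_mem_associatedPrimes_of_length_eq_idealDepth hPm hlen hmem hreg
  rw [← hlen]
  rcases hPQ.eq_or_lt with rfl | hlt
  · exact localDepth_le_length_of_mem_associatedPrimes P hmem hreg hQ
  let p : PrimeSpectrum A := ⟨P, inferInstance⟩
  let q : PrimeSpectrum A := ⟨Q, IsAssociatedPrime.isPrime hQ⟩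
  have hpq : Order.coheight q + 1 ≤ Order.coheight p :=
    Order.coheight_add_one_le (show p < q from hlt)
  obtain ⟨rs, hrs_len, hrs_mem, hrs⟩ := exists_isRegular_length_eq_idealDepth (maximalIdeal A)
  have hd : (rs.length : ℕ∞) ≤ xs.length + Order.coheight q :=
    length_le_length_add_coheight (fun r hr ↦ hPm (hmem r hr)) hreg hrs_mem hrs hQ
  have hdim : Order.height p + Order.coheight p ≤ 1 + ringDepth A := by
    rw [← WithBot.coe_le_coe]
    refine le_trans ?_ h
    rw [ringKrullDim, Order.krullDim_eq_iSup_height_add_coheight_of_nonempty, WithBot.coe_le_coe]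
    exact le_iSup (fun a : PrimeSpectrum A ↦ Order.height a + Order.coheight a) p
  refine (localDepth_le_primeHeight P).trans ?_
  rw [← (ENat.addLECancellable_of_ne_top (coheight_lt_top p).ne).add_le_add_iff_right]
  calc Order.height p + Order.coheight p ≤ 1 + rs.length := by rwa [hrs_len]
    _ ≤ 1 + (xs.length + Order.coheight q) := by gcongr
    _ = xs.length + (Order.coheight q + 1) := by ring
    _ ≤ xs.length + Order.coheight p := by gcongr

lemma ringKrullDim_le_of_forall_idealDepth_eq_localDepth
    (h : ∀ (P : Ideal A) [P.IsPrime], idealDepth P A = localDepth P) :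
    ringKrullDim A ≤ ((1 + ringDepth A : ℕ∞) : WithBot ℕ∞) := by
  obtain ⟨xs, hlen, hmem, hreg⟩ := exists_isRegular_length_eq_idealDepth (maximalIdeal A)
  have hass (P : Ideal A) [P.IsPrime] (hP : Ideal.ofList xs ≤ P) :
      P ∈ associatedPrimes A (A ⧸ (Ideal.ofList xs • ⊤ : Submodule A A)) := by
    have hmemP : ∀ r ∈ xs, r ∈ P := fun r hr ↦ hP (Ideal.subset_span hr)
    have hregP := isRegular_map_algebraMap_localization P hmemP hreg
    have hlenP : ((xs.map (algebraMap A (Localization.AtPrime P))).length : ℕ∞) =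
        idealDepth (maximalIdeal (Localization.AtPrime P)) (Localization.AtPrime P) := by
      refine (length_le_idealDepth (map_algebraMap_mem_maximalIdeal P hmemP) hregP).antisymm ?_
      rw [List.length_map, hlen]
      exact (h P).symm.le.trans (idealDepth_mono (le_maximalIdeal_of_isPrime P) A)
    obtain ⟨Q, hQ, hle⟩ := exists_le_mem_associatedPrimes_of_length_eq_idealDepth le_rfl hlenP
      (map_algebraMap_mem_maximalIdeal P hmemP) hregP
    rw [← maximalIdeal_mem_associatedPrimes_localization_iff,
      (maximalIdeal.isMaximal _).eq_of_le (IsAssociatedPrime.isPrime hQ).ne_top hle]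
    exact hQ
  have hfin : Finite (PrimeSpectrum (A ⧸ Ideal.ofList xs)) := by
    have := (associatedPrimes.finite A (A ⧸ (Ideal.ofList xs • ⊤ : Submodule A A))).to_subtype
    let f (p : PrimeSpectrum (A ⧸ Ideal.ofList xs)) :
        associatedPrimes A (A ⧸ (Ideal.ofList xs • ⊤ : Submodule A A)) :=
      ⟨p.asIdeal.comap (Ideal.Quotient.mk _), hass _ <| by
        simpa using Ideal.ker_le_comap (K := p.asIdeal) (Ideal.Quotient.mk (Ideal.ofList xs))⟩
    refine Finite.of_injective f fun p q hpq ↦ PrimeSpectrum.ext ?_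
    exact Ideal.comap_injective_of_surjective _ Ideal.Quotient.mk_surjective
      (congrArg Subtype.val hpq)
  rw [← ringKrullDim_add_length_eq_ringKrullDim_of_isRegular xs hreg, ringDepth, ← hlen,
    WithBot.coe_add]
  exact add_le_add_left ringKrullDim_le_one_of_finite_primeSpectrum _

end Main

theorem almostCM_local_iff_dim_le_one_add_depth {A : Type*} [CommRing A] [IsNoetherianRing A]
    [IsLocalRing A] :
    (∀ (P : Ideal A) [P.IsPrime], idealDepth P A = localDepth P) ↔
      ringKrullDim A ≤ ((1 + ringDepth A : ℕ∞) : WithBot ℕ∞) :=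
  ⟨ringKrullDim_le_of_forall_idealDepth_eq_localDepth,
    fun h P _ ↦ idealDepth_eq_localDepth_of_ringKrullDim_le h P⟩
end

section
/- Let u: (A,m) → (B,n) be a local flat morphism of noetherian local rings. If B is almost Cohen-Macaulay, then A is almost Cohen-Macaulay and the closed fiber B/mB is almost Cohen-Macaulay. -/
open IsLocalRing

open scoped Pointwise

universe u v

theorem Submodule.mem_ideal_smul_top_iff_exists_sum {R M : Type*} [CommRing R] [AddCommGroup M]
    [Module R M] (I : Ideal R) (v : M) :
    v ∈ I • (⊤ : Submodule R M) ↔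
      ∃ a : M →₀ R, (∀ w, a w ∈ I) ∧ a.sum (fun w c ↦ c • w) = v := by
  have h := Submodule.mem_ideal_smul_span_iff_exists_sum I (id : M → M) v
  simpa using h

theorem Module.Flat.mem_colon_smul_top {R M : Type*} [CommRing R] [AddCommGroup M]
    [Module R M] [Module.Flat R M] {I : Ideal R} {x : R} {v : M}
    (h : x • v ∈ I • (⊤ : Submodule R M)) :
    v ∈ (I.colon {x}) • (⊤ : Submodule R M) := by
  obtain ⟨a, ha, hsum⟩ := (Submodule.mem_ideal_smul_top_iff_exists_sum I _).mp h
  let f : Option a.support → R := fun o ↦ o.elim x (fun w ↦ -a w)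
  let g : Option a.support → M := fun o ↦ o.elim v (fun w ↦ w)
  have hfg : ∑ i, f i • g i = 0 := by
    rw [Fintype.sum_option]
    simp only [f, g, Option.elim, neg_smul, Finset.sum_neg_distrib]
    rw [Finset.sum_coe_sort a.support (fun w ↦ a w • w), ← hsum, Finsupp.sum, add_neg_cancel]
  obtain ⟨k, c, z, hz, hc⟩ := Module.Flat.isTrivialRelation_of_sum_smul_eq_zero hfg
  have hv : v = ∑ j, c none j • z j := hz none
  rw [hv]
  refine Submodule.sum_mem _ fun j _ ↦ Submodule.smul_mem_smul ?_ trivial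
  have hj := hc j
  rw [Fintype.sum_option] at hj
  simp only [f, Option.elim] at hj
  rw [Submodule.mem_colon_singleton, smul_eq_mul, mul_comm, eq_neg_of_add_eq_zero_left hj]
  exact neg_mem (sum_mem fun i _ ↦ I.mul_mem_right _ (neg_mem (ha _)))

theorem Ideal.mem_map_smul_top_iff {R S M : Type*} [CommRing R] [CommRing S] [Algebra R S]
    [AddCommGroup M] [Module R M] [Module S M] [IsScalarTower R S M] (I : Ideal R) (v : M) :
    v ∈ I.map (algebraMap R S) • (⊤ : Submodule S M) ↔ v ∈ I • (⊤ : Submodule R M) := by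
  have h := Ideal.smul_restrictScalars I (⊤ : Submodule S M)
  rw [Submodule.restrictScalars_top] at h
  rw [← h, Submodule.restrictScalars_mem]

theorem Ideal.smul_mem_of_mem_colon_smul_top {R M : Type*} [CommRing R] [AddCommGroup M]
    [Module R M] {I : Ideal R} {x : R} {v : M}
    (h : v ∈ (I.colon {x}) • (⊤ : Submodule R M)) : x • v ∈ I • (⊤ : Submodule R M) := by
  have hle : (I.colon {x}) • (⊤ : Submodule R M) ≤
      (I • (⊤ : Submodule R M)).comap (LinearMap.lsmul R M x) := by
    refine Submodule.smul_le.mpr fun a ha n _ ↦ ?_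
    rw [Submodule.mem_comap, LinearMap.lsmul_apply, smul_smul, mul_comm]
    exact Submodule.smul_mem_smul (Submodule.mem_colon_singleton.mp ha) trivial
  exact hle h

theorem Submodule.exists_sum_smul_eq_of_mem_span_range_smul_top {R M ι : Type*} [CommRing R]
    [AddCommGroup M] [Module R M] [Fintype ι] {f : ι → R} {w : M}
    (h : w ∈ Ideal.span (Set.range f) • (⊤ : Submodule R M)) :
    ∃ u : ι → M, ∑ i, f i • u i = w := by
  refine Submodule.smul_induction_on h (fun a ha n _ ↦ ?_) (fun p q hp hq ↦ ?_)
  · obtain ⟨c, rfl⟩ := (Submodule.mem_span_range_iff_exists_fun R).mp ha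
    refine ⟨fun i ↦ c i • n, ?_⟩
    simp_rw [Finset.sum_smul, smul_eq_mul, smul_smul, mul_comm]
  · obtain ⟨u, rfl⟩ := hp
    obtain ⟨v, rfl⟩ := hq
    exact ⟨u + v, by simp [smul_add, Finset.sum_add_distrib]⟩

section LocalFlat

variable {A B N : Type*} [CommRing A] [CommRing B] [IsNoetherianRing A] [IsNoetherianRing B]
  [IsLocalRing A] [IsLocalRing B] [Algebra A B] [IsLocalHom (algebraMap A B)]
  [AddCommGroup N] [Module A N] [Module B N] [IsScalarTower A B N] [Module.Finite B N]
  [Module.Flat A N]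

theorem mem_smul_top_of_smul_mem_of_flat {y : B}
    (hy : ∀ v : N, y • v ∈ maximalIdeal A • (⊤ : Submodule A N) →
      v ∈ maximalIdeal A • (⊤ : Submodule A N)) (I : Ideal A) :
    ∀ v : N, y • v ∈ I • (⊤ : Submodule A N) → v ∈ I • (⊤ : Submodule A N) := by
  induction I using WellFoundedGT.induction with
  | ind I ih =>
  by_cases hI : I = ⊤
  · simp [hI]
  by_cases hIm : maximalIdeal A ≤ I
  · rwa [(eq_maximalIdeal (I := I) ?_)]
    rw [← (IsLocalRing.maximalIdeal.isMaximal A).eq_of_le hI hIm]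
    infer_instance
  obtain ⟨x, hxm, hxI⟩ := SetLike.not_le_iff_exists.mp hIm
  have key : ∀ v : N, y • v ∈ I • (⊤ : Submodule A N) →
      ∃ u ∈ I • (⊤ : Submodule A N), ∃ w : N, v = u + x • w ∧
        y • w ∈ I.colon {x} • (⊤ : Submodule A N) := by
    intro v hv
    have hlt : I < I ⊔ Ideal.span {x} := by
      refine lt_of_le_of_ne le_sup_left fun h ↦ hxI ?_
      rw [h]
      exact Ideal.mem_sup_right (Ideal.mem_span_singleton_self x)
    have h1 := ih _ hlt v (Submodule.smul_mono_left le_sup_left hv)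
    rw [Submodule.sup_smul, Submodule.ideal_span_singleton_smul] at h1
    obtain ⟨u, hu, w', hw', rfl⟩ := Submodule.mem_sup.mp h1
    obtain ⟨w, -, rfl⟩ := (Submodule.mem_smul_pointwise_iff_exists _ _ _).mp hw'
    refine ⟨u, hu, w, rfl, Module.Flat.mem_colon_smul_top ?_⟩
    have hyu : y • u ∈ I • (⊤ : Submodule A N) := by
      rw [← Ideal.mem_map_smul_top_iff (S := B)] at hu ⊢
      exact Submodule.smul_mem _ _ hu
    rw [smul_comm]
    rw [smul_add] at hv
    exact (Submodule.add_mem_iff_right _ hyu).mp hv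
  by_cases hcol : I.colon {x} = I
  · let J := I.map (algebraMap A B) • (⊤ : Submodule B N)
    let K : Submodule B N := J.comap (LinearMap.lsmul B N y)
    have hK : K ≤ J ⊔ Ideal.span {algebraMap A B x} • K := by
      intro v hv
      obtain ⟨u, hu, w, rfl, hw⟩ := key v ((Ideal.mem_map_smul_top_iff I _).mp hv)
      rw [hcol] at hw
      refine Submodule.add_mem_sup ((Ideal.mem_map_smul_top_iff I _).mpr hu) ?_
      rw [← algebraMap_smul B x w]
      exact Submodule.smul_mem_smul (Ideal.mem_span_singleton_self _)
        ((Ideal.mem_map_smul_top_iff I _).mpr hw)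
    have hle : K ≤ J := by
      refine Submodule.le_of_le_smul_of_le_jacobson_bot (I := Ideal.span {algebraMap A B x})
        (IsNoetherian.noetherian K) ?_ hK
      rw [IsLocalRing.jacobson_eq_maximalIdeal _ bot_ne_top, Ideal.span_singleton_le_iff_mem]
      exact fun h ↦ hxm (isUnit_of_map_unit (algebraMap A B) x h)
    exact fun v hv ↦ (Ideal.mem_map_smul_top_iff I v).mp
      (hle ((Ideal.mem_map_smul_top_iff I _).mpr hv))
  · intro v hv
    obtain ⟨u, hu, w, rfl, hw⟩ := key v hv
    have hIc : I < I.colon {x} := by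
      refine lt_of_le_of_ne (fun a ha ↦ ?_) (Ne.symm hcol)
      rw [Submodule.mem_colon_singleton]
      exact I.mul_mem_right _ ha
    exact add_mem hu (Ideal.smul_mem_of_mem_colon_smul_top (ih _ hIc w hw))

theorem isSMulRegular_of_flat {y : B}
    (hy : ∀ v : N, y • v ∈ maximalIdeal A • (⊤ : Submodule A N) →
      v ∈ maximalIdeal A • (⊤ : Submodule A N)) : IsSMulRegular N y := by
  rw [isSMulRegular_iff_right_eq_zero_of_smul]
  intro v hv
  have h := mem_smul_top_of_smul_mem_of_flat hy ⊥ v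
  simpa [hv] using h

theorem flat_quotSMulTop {y : B}
    (hy : ∀ v : N, y • v ∈ maximalIdeal A • (⊤ : Submodule A N) →
      v ∈ maximalIdeal A • (⊤ : Submodule A N)) : Module.Flat A (QuotSMulTop y N) := by
  refine Module.Flat.of_forall_isTrivialRelation fun {l f x} hfx ↦ ?_
  choose n hn using fun i ↦ Submodule.Quotient.mk_surjective _ (x i)
  have hmem : ∑ i, f i • n i ∈ (y • ⊤ : Submodule B N) := by
    rw [← Submodule.Quotient.mk_eq_zero, ← hfx, ← Submodule.mkQ_apply, map_sum]
    refine Finset.sum_congr rfl fun i _ ↦ ?_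
    rw [← hn, Submodule.mkQ_apply, Submodule.Quotient.mk_smul]
  obtain ⟨w, -, hw⟩ := (Submodule.mem_smul_pointwise_iff_exists _ _ _).mp hmem
  have hwI : w ∈ Ideal.span (Set.range f) • (⊤ : Submodule A N) := by
    refine mem_smul_top_of_smul_mem_of_flat hy _ w ?_
    rw [hw]
    exact sum_mem fun i _ ↦
      Submodule.smul_mem_smul (Ideal.subset_span (Set.mem_range_self i)) trivial
  obtain ⟨u, hu⟩ := Submodule.exists_sum_smul_eq_of_mem_span_range_smul_top hwI
  have hrel : ∑ i, f i • (n i - y • u i) = 0 := by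
    simp_rw [smul_sub, Finset.sum_sub_distrib, smul_comm _ y, ← Finset.smul_sum]
    rw [hu, hw, sub_self]
  obtain ⟨k, c, z, hz, hc⟩ := Module.Flat.isTrivialRelation_of_sum_smul_eq_zero hrel
  refine ⟨k, c, fun j ↦ Submodule.Quotient.mk (z j), fun i ↦ ?_, hc⟩
  have hxi : x i = Submodule.Quotient.mk (n i - y • u i) := by
    rw [← hn, Submodule.Quotient.mk_sub, eq_comm, sub_eq_self, Submodule.Quotient.mk_eq_zero]
    exact Submodule.smul_mem_pointwise_smul _ _ _ trivial
  rw [hxi, show n i - y • u i = ∑ j, c i j • z j from hz i, ← Submodule.mkQ_apply, map_sum]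
  rfl

end LocalFlat

/-- A module over a local ring has nonzero socle if some nonzero element is annihilated by the
maximal ideal. -/
def HasSocle (R : Type*) (M : Type*) [CommRing R] [IsLocalRing R] [AddCommGroup M]
    [Module R M] : Prop :=
  ∃ v : M, v ≠ 0 ∧ ∀ y ∈ maximalIdeal R, y • v = 0

/-- `HasMaximalRegular R n M` says that some `M`-regular sequence of length `n` in the maximal
ideal of `R` cannot be extended, as its quotient has nonzero socle. -/
def HasMaximalRegular (R : Type*) [CommRing R] [IsLocalRing R] :
    ℕ → ∀ (M : Type v) [AddCommGroup M] [Module R M], Prop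
  | 0, M, _, _ => HasSocle R M
  | n + 1, M, _, _ =>
    ∃ x ∈ maximalIdeal R, IsSMulRegular M x ∧ HasMaximalRegular R n (QuotSMulTop x M)

theorem supportDim_nonneg (R M : Type*) [CommRing R] [AddCommGroup M] [Module R M]
    [Nontrivial M] : 0 ≤ Module.supportDim R M := by
  have : Nonempty (Module.support R M) := Module.nonempty_support_of_nontrivial.to_subtype
  exact Order.krullDim_nonneg

section MaximalRegular

variable {R : Type*} [CommRing R] [IsLocalRing R]

theorem HasSocle.congr {M : Type*} {M' : Type*} [AddCommGroup M] [Module R M] [AddCommGroup M']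
    [Module R M'] (e : M ≃ₗ[R] M') (h : HasSocle R M) : HasSocle R M' := by
  obtain ⟨v, hv, hmv⟩ := h
  exact ⟨e v, by simpa using hv, fun y hy ↦ by rw [← map_smul, hmv y hy, map_zero]⟩

theorem HasMaximalRegular.congr {n : ℕ} {M M' : Type*} [AddCommGroup M] [Module R M]
    [AddCommGroup M'] [Module R M'] (e : M ≃ₗ[R] M') (h : HasMaximalRegular R n M) :
    HasMaximalRegular R n M' := by
  induction n generalizing M M' with
  | zero => exact HasSocle.congr e h
  | succ n ih =>
    obtain ⟨x, hx, hreg, hn⟩ := h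
    exact ⟨x, hx, (e.isSMulRegular_congr x).mp hreg, ih (QuotSMulTop.congr x e) hn⟩

theorem HasMaximalRegular.exists_list {n : ℕ} {M : Type*} [AddCommGroup M] [Module R M]
    (h : HasMaximalRegular R n M) :
    ∃ rs : List R, rs.length = n ∧ (∀ r ∈ rs, r ∈ maximalIdeal R) ∧
      RingTheory.Sequence.IsWeaklyRegular M rs ∧
      HasSocle R (M ⧸ (Ideal.ofList rs • ⊤ : Submodule R M)) := by
  induction n generalizing M with
  | zero =>
    refine ⟨[], rfl, by simp, .nil R M, ?_⟩
    exact HasSocle.congr (Submodule.quotEquivOfEqBot _ (by simp)).symm h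
  | succ n ih =>
    obtain ⟨x, hx, hreg, hn⟩ := h
    obtain ⟨rs, hlen, hmem, hrs, hsoc⟩ := ih hn
    exact ⟨x :: rs, by simp [hlen], List.forall_mem_cons.mpr ⟨hx, hmem⟩, .cons hreg hrs,
      HasSocle.congr (Submodule.quotOfListConsSMulTopEquivQuotSMulTopInner M x rs).symm hsoc⟩

theorem HasMaximalRegular.of_list {M : Type*} [AddCommGroup M] [Module R M] {rs : List R}
    (hmem : ∀ r ∈ rs, r ∈ maximalIdeal R) (hrs : RingTheory.Sequence.IsWeaklyRegular M rs)
    (h : HasSocle R (M ⧸ (Ideal.ofList rs • ⊤ : Submodule R M))) :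
    HasMaximalRegular R rs.length M := by
  induction rs generalizing M with
  | nil => exact HasSocle.congr (Submodule.quotEquivOfEqBot _ (by simp)) h
  | cons x rs ih =>
    rw [RingTheory.Sequence.isWeaklyRegular_cons_iff] at hrs
    exact ⟨x, hmem x (by simp), hrs.1, ih (fun r hr ↦ hmem r (by simp [hr])) hrs.2 <|
      HasSocle.congr (Submodule.quotOfListConsSMulTopEquivQuotSMulTopInner M x rs) h⟩

theorem HasMaximalRegular.exists_isRegular {n : ℕ} {M : Type*} [AddCommGroup M] [Module R M]
    (h : HasMaximalRegular R n M) :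
    ∃ rs : List R, rs.length = n ∧ (∀ r ∈ rs, r ∈ maximalIdeal R) ∧
      RingTheory.Sequence.IsRegular M rs := by
  obtain ⟨rs, hlen, hmem, hrs, v, hv, -⟩ := h.exists_list
  refine ⟨rs, hlen, hmem, hrs, fun htop ↦ hv ?_⟩
  have := Submodule.Quotient.subsingleton_iff.mpr htop.symm
  exact Subsingleton.elim _ _

theorem not_hasSocle_of_isSMulRegular {M : Type*} [AddCommGroup M] [Module R M] {x : R}
    (hx : x ∈ maximalIdeal R) (hreg : IsSMulRegular M x) : ¬ HasSocle R M :=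
  fun ⟨v, hv, hmv⟩ ↦ hv ((isSMulRegular_iff_right_eq_zero_of_smul.mp hreg) v (hmv x hx))

variable [IsNoetherianRing R]

theorem exists_isSMulRegular_of_not_hasSocle {M : Type*} [AddCommGroup M] [Module R M]
    [Module.Finite R M] (h : ¬ HasSocle R M) : ∃ x ∈ maximalIdeal R, IsSMulRegular M x := by
  have hsub : Subsingleton (R ⧸ maximalIdeal R →ₗ[R] M) := by
    refine subsingleton_of_forall_eq 0 fun f ↦ ?_
    by_contra hf
    refine h ⟨f (Submodule.Quotient.mk 1), fun h0 ↦ hf ?_, fun y hy ↦ ?_⟩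
    · refine Submodule.linearMap_qext _ (LinearMap.ext_ring ?_)
      simpa using h0
    · rw [← map_smul, ← Submodule.Quotient.mk_smul, smul_eq_mul, mul_one,
        (Submodule.Quotient.mk_eq_zero _).mpr hy, map_zero]
  obtain ⟨x, hx, hreg⟩ := IsSMulRegular.subsingleton_linearMap_iff.mp hsub
  exact ⟨x, by rwa [Ideal.annihilator_quotient] at hx, hreg⟩

theorem exists_hasMaximalRegular (M : Type*) [AddCommGroup M] [Module R M]
    [Module.Finite R M] [Nontrivial M] : ∃ n : ℕ, HasMaximalRegular R n M := by
  obtain ⟨d, hd⟩ : ∃ d : ℕ, Module.supportDim R M < d := by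
    have h : Module.supportDim R M < ⊤ :=
      (Module.supportDim_le_ringKrullDim R M).trans_lt ringKrullDim_lt_top
    have hbot := Module.supportDim_ne_bot_of_nontrivial R M
    lift Module.supportDim R M to ℕ∞ using hbot with d
    lift d to ℕ using (by rintro rfl; exact h.ne rfl)
    exact ⟨d + 1, by exact_mod_cast Nat.lt_succ_self d⟩
  induction d generalizing M with
  | zero =>
    exact absurd hd (not_lt_of_ge (by exact_mod_cast supportDim_nonneg R M))
  | succ d ih =>
    by_cases h : HasSocle R M
    · exact ⟨0, h⟩
    obtain ⟨x, hx, hreg⟩ := exists_isSMulRegular_of_not_hasSocle h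
    have := nontrivial_quotSMulTop_of_mem_maximalIdeal (L := M) hx
    have hdim := Module.supportDim_quotSMulTop_succ_eq_supportDim hreg hx
    obtain ⟨n, hn⟩ := ih (QuotSMulTop x M) (by
      rw [← hdim] at hd
      push_cast at hd
      exact lt_of_add_lt_add_right hd)
    exact ⟨n + 1, x, hx, hreg, hn⟩

theorem HasMaximalRegular.le_supportDim {M : Type*} [AddCommGroup M] [Module R M]
    [Module.Finite R M] {n : ℕ} (h : HasMaximalRegular R n M) :
    (n : WithBot ℕ∞) ≤ Module.supportDim R M := by
  obtain ⟨rs, rfl, hmem, hrs⟩ := h.exists_isRegular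
  rw [← Module.supportDim_add_length_eq_supportDim_of_isRegular rs hrs]
  have := hrs.quot_ofList_smul_nontrivial ⊤
  exact le_add_of_nonneg_left (supportDim_nonneg R _)

end MaximalRegular

open CategoryTheory.Abelian in
theorem HasMaximalRegular.length_le {R M : Type u} [CommRing R] [IsLocalRing R]
    [IsNoetherianRing R] [AddCommGroup M] [Module R M] [Module.Finite R M] {n : ℕ}
    (h : HasMaximalRegular R n M) {rs : List R} (hmem : ∀ r ∈ rs, r ∈ maximalIdeal R)
    (hrs : RingTheory.Sequence.IsRegular M rs) : rs.length ≤ n := by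
  let K := ModuleCat.of R (Shrink.{u} (R ⧸ maximalIdeal R))
  have rees (L : Type u) [AddCommGroup L] [Module R L] [Module.Finite R L] [Nontrivial L] (d : ℕ) :
      (∀ i < d, Subsingleton (Ext K (ModuleCat.of R L) i)) ↔
        ∃ rs : List R, rs.length = d ∧ (∀ r ∈ rs, r ∈ maximalIdeal R) ∧
          RingTheory.Sequence.IsRegular L rs :=
    (ModuleCat.exists_isRegular_tfae (maximalIdeal R) d (ModuleCat.of R L)
      (Submodule.top_ne_ideal_smul_of_le_jacobson_annihilator
        (maximalIdeal_le_jacobson _)).symm.lt_top).out 1 3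
  induction n generalizing M rs with
  | zero =>
    match rs with
    | [] => simp
    | x :: rs =>
      exact absurd h (not_hasSocle_of_isSMulRegular (hmem x (by simp))
        ((RingTheory.Sequence.isRegular_cons_iff M x rs).mp hrs).1)
  | succ n ih =>
    obtain ⟨x, hx, hreg, hn⟩ := h
    match rs with
    | [] => simp
    | r :: rs =>
      have := hrs.nontrivial
      have := nontrivial_quotSMulTop_of_mem_maximalIdeal (L := M) hx
      have hext := (rees M (rs.length + 1)).mpr ⟨r :: rs, rfl, hmem, hrs⟩
      have hext' : ∀ i < rs.length, Subsingleton (Ext K (ModuleCat.of R (QuotSMulTop x M)) i) := by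
        intro i hi
        have zero1 := AddCommGrpCat.isZero_of_iff_subsingleton.mpr (hext i (by omega))
        have zero2 := AddCommGrpCat.isZero_of_iff_subsingleton.mpr (hext (i + 1) (by omega))
        exact AddCommGrpCat.subsingleton_of_isZero <|
          CategoryTheory.ShortComplex.Exact.isZero_of_both_zeros
            (Ext.covariant_sequence_exact₃' K
              (IsSMulRegular.smulShortComplex_shortExact (M := ModuleCat.of R M) hreg) i (i + 1) rfl)
            (zero1.eq_zero_of_src _) (zero2.eq_zero_of_tgt _)
      obtain ⟨ss, hlen, hssmem, hss⟩ := (rees (QuotSMulTop x M) rs.length).mp hext'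
      simpa [← hlen] using ih hn hssmem hss

theorem nontrivial_fiber (A B : Type*) [CommRing A] [CommRing B] [IsLocalRing A] [IsLocalRing B]
    [Algebra A B] [IsLocalHom (algebraMap A B)] :
    Nontrivial (B ⧸ (maximalIdeal A).map (algebraMap A B)) := by
  refine Ideal.Quotient.nontrivial_iff.mpr fun htop ↦ ?_
  exact (map_maximalIdeal_lt_top (algebraMap A B)).ne htop

section Fiber

variable {A B : Type*} [CommRing A] [CommRing B] [IsLocalRing A] [IsLocalRing B] [Algebra A B]
  [IsLocalHom (algebraMap A B)]

theorem HasMaximalRegular.of_flat_of_hasSocle {N : Type*} [AddCommGroup N] [Module A N]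
    [Module B N] [IsScalarTower A B N] [Module.Flat A N] {a : ℕ} (ha : HasMaximalRegular A a A)
    (h : HasSocle B (N ⧸ ((maximalIdeal A).map (algebraMap A B) • ⊤ : Submodule B N))) :
    HasMaximalRegular B a N := by
  obtain ⟨rs, rfl, hmem, hrs, v, hv, hmv⟩ := ha.exists_list
  obtain ⟨c, rfl⟩ := Submodule.Quotient.mk_surjective _ v
  obtain ⟨w, hw, hmw⟩ := h
  obtain ⟨n, rfl⟩ := Submodule.Quotient.mk_surjective _ w
  set I := Ideal.ofList rs
  have hreg : RingTheory.Sequence.IsWeaklyRegular N (rs.map (algebraMap A B)) := by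
    rw [RingTheory.Sequence.isWeaklyRegular_map_algebraMap_iff,
      ← (TensorProduct.rid A N).isWeaklyRegular_congr]
    exact hrs.isWeaklyRegular_lTensor
  have hc : c ∉ I := fun h ↦ hv ((Submodule.Quotient.mk_eq_zero _).mpr (by simpa using h))
  have hmc : ∀ x ∈ maximalIdeal A, x * c ∈ I := fun x hx ↦ by
    have := hmv x hx
    rw [← Submodule.Quotient.mk_smul, Submodule.Quotient.mk_eq_zero] at this
    simpa using this
  have hcolon : I.colon {c} ≤ maximalIdeal A := by
    refine le_maximalIdeal fun htop ↦ hc ?_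
    have h1 : (1 : A) ∈ I.colon {c} := htop ▸ trivial
    simpa [Submodule.mem_colon_singleton] using h1
  rw [← List.length_map (f := algebraMap A B)]
  refine .of_list (fun r hr ↦ ?_) hreg ⟨Submodule.Quotient.mk (c • n), fun h0 ↦ hw ?_, ?_⟩
  · obtain ⟨s, hs, rfl⟩ := List.mem_map.mp hr
    exact fun hu ↦ hmem s hs (isUnit_of_map_unit (algebraMap A B) s hu)
  · rw [Submodule.Quotient.mk_eq_zero, ← Ideal.map_ofList, Ideal.mem_map_smul_top_iff] at h0
    rw [Submodule.Quotient.mk_eq_zero, Ideal.mem_map_smul_top_iff]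
    exact Submodule.smul_mono_left hcolon (Module.Flat.mem_colon_smul_top h0)
  · intro y hy
    have hyn := hmw y hy
    rw [← Submodule.Quotient.mk_smul, Submodule.Quotient.mk_eq_zero,
      Ideal.mem_map_smul_top_iff] at hyn
    rw [← Submodule.Quotient.mk_smul, Submodule.Quotient.mk_eq_zero, ← Ideal.map_ofList,
      Ideal.mem_map_smul_top_iff, smul_comm]
    refine Ideal.smul_mem_of_mem_colon_smul_top (Submodule.smul_mono_left (fun x hx ↦ ?_) hyn)
    rw [Submodule.mem_colon_singleton]
    exact hmc x hx

variable [IsNoetherianRing A] [IsNoetherianRing B]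

theorem HasMaximalRegular.add_of_flat {N : Type*} [AddCommGroup N] [Module A N]
    [Module B N] [IsScalarTower A B N] [Module.Flat A N] [Module.Finite B N] {a f : ℕ}
    (ha : HasMaximalRegular A a A)
    (hf : HasMaximalRegular B f
      (N ⧸ ((maximalIdeal A).map (algebraMap A B) • ⊤ : Submodule B N))) :
    HasMaximalRegular B (a + f) N := by
  induction f generalizing N with
  | zero => exact .of_flat_of_hasSocle ha hf
  | succ f ih =>
    obtain ⟨y, hy, hreg, hf⟩ := hf
    have hyN : ∀ v : N, y • v ∈ maximalIdeal A • (⊤ : Submodule A N) →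
        v ∈ maximalIdeal A • (⊤ : Submodule A N) := by
      intro v hv
      rw [← Ideal.mem_map_smul_top_iff (S := B), ← Submodule.Quotient.mk_eq_zero] at hv ⊢
      exact isSMulRegular_iff_right_eq_zero_of_smul.mp hreg _ hv
    have := flat_quotSMulTop hyN
    obtain ⟨s, hs⟩ := IsNoetherian.noetherian ((maximalIdeal A).map (algebraMap A B))
    refine ⟨y, hy, isSMulRegular_of_flat hyN, ih (hf.congr ?_)⟩
    have hL : (maximalIdeal A).map (algebraMap A B) = Ideal.ofList s.toList := by
      rw [← hs]
      simp [Ideal.ofList]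
    rw [hL]
    exact (Submodule.quotOfListConsSMulTopEquivQuotSMulTopOuter N y s.toList).symm ≪≫ₗ
      Submodule.quotOfListConsSMulTopEquivQuotSMulTopInner N y s.toList

variable (A B)

theorem ringKrullDim_add_ringKrullDim_fiber_le [Module.Flat A B] :
    ringKrullDim A + ringKrullDim (B ⧸ (maximalIdeal A).map (algebraMap A B)) ≤
      ringKrullDim B := by
  have : (maximalIdeal B).LiesOver (maximalIdeal A) :=
    ⟨(maximalIdeal_comap (algebraMap A B)).symm⟩
  have h := Ideal.height_eq_height_add_of_liesOver_of_hasGoingDown (maximalIdeal A)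
    (maximalIdeal B)
  have := nontrivial_fiber A B
  have : IsLocalRing (B ⧸ (maximalIdeal A).map (algebraMap A B)) :=
    .of_surjective' _ Ideal.Quotient.mk_surjective
  have hmax : (maximalIdeal B).map (Ideal.Quotient.mk ((maximalIdeal A).map (algebraMap A B))) =
      maximalIdeal _ :=
    map_maximalIdeal_of_surjective _ Ideal.Quotient.mk_surjective
  rw [hmax] at h
  rw [← maximalIdeal_height_eq_ringKrullDim, ← maximalIdeal_height_eq_ringKrullDim,
    ← maximalIdeal_height_eq_ringKrullDim, h]
  rfl

end Fiber

theorem le_idealDepth {R M : Type*} [CommRing R] [AddCommGroup M] [Module R M] {I : Ideal R}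
    {rs : List R} (hmem : ∀ r ∈ rs, r ∈ I) (hrs : RingTheory.Sequence.IsRegular M rs) :
    (rs.length : ℕ∞) ≤ idealDepth I M :=
  le_sSup ⟨rs, rfl, hmem, hrs⟩

theorem HasMaximalRegular.ringDepth_eq {R : Type*} [CommRing R] [IsLocalRing R]
    [IsNoetherianRing R] {n : ℕ} (h : HasMaximalRegular R n R) : ringDepth R = n := by
  refine le_antisymm (sSup_le ?_) ?_
  · rintro - ⟨rs, rfl, hmem, hrs⟩
    exact_mod_cast h.length_le hmem hrs
  · obtain ⟨rs, rfl, hmem, hrs⟩ := h.exists_isRegular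
    exact le_idealDepth hmem hrs

theorem HasMaximalRegular.le_idealDepth_quotient {R : Type*} [CommRing R] [IsLocalRing R]
    {I : Ideal R} {n : ℕ} (h : HasMaximalRegular R n (R ⧸ I)) :
    (n : ℕ∞) ≤ idealDepth ((maximalIdeal R).map (Ideal.Quotient.mk I)) (R ⧸ I) := by
  obtain ⟨rs, rfl, hmem, hrs⟩ := h.exists_isRegular
  rw [← List.length_map (f := Ideal.Quotient.mk I)]
  refine le_idealDepth (fun r hr ↦ ?_) ?_
  · obtain ⟨s, hs, rfl⟩ := List.mem_map.mp hr
    exact Ideal.mem_map_of_mem _ (hmem s hs)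
  · refine (AddEquiv.isRegular_congr (e := AddEquiv.refl (R ⧸ I)) ?_).mp hrs
    exact List.forall₂_map_right_iff.mpr <| List.forall₂_same.mpr fun r _ x ↦ rfl

theorem almostCM_descends_along_flat {A B : Type*} [CommRing A] [CommRing B]
    [IsNoetherianRing A] [IsNoetherianRing B] [IsLocalRing A] [IsLocalRing B]
    [Algebra A B] [Module.Flat A B] [IsLocalHom (algebraMap A B)]
    (hB : IsAlmostCM B) :
    IsAlmostCM A ∧
      IsAlmostCMWith (B ⧸ (maximalIdeal A).map (algebraMap A B))
        ((maximalIdeal B).map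
          (Ideal.Quotient.mk ((maximalIdeal A).map (algebraMap A B)))) := by
  have hdim := ringKrullDim_add_ringKrullDim_fiber_le A B
  have := nontrivial_fiber A B
  let e : (B ⧸ (maximalIdeal A).map (algebraMap A B)) ≃ₗ[B]
      B ⧸ ((maximalIdeal A).map (algebraMap A B) • ⊤ : Submodule B B) :=
    Submodule.quotEquivOfEq _ _ (by simp)
  obtain ⟨a, ha⟩ := exists_hasMaximalRegular (R := A) A
  obtain ⟨f, hf⟩ := exists_hasMaximalRegular (R := B)
    (B ⧸ (maximalIdeal A).map (algebraMap A B))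
  have hdB := (ha.add_of_flat (hf.congr e)).ringDepth_eq
  have haA := ha.le_supportDim
  have hfF := hf.le_supportDim
  have hF := hf.le_idealDepth_quotient
  rw [Module.supportDim_self_eq_ringKrullDim] at haA
  rw [Module.supportDim_quotient_eq_ringKrullDim] at hfF
  unfold IsAlmostCM at hB ⊢
  unfold IsAlmostCMWith
  rw [hdB] at hB
  rw [ha.ringDepth_eq]
  have hsum := hdim.trans hB
  generalize ringKrullDim A = dA at *
  generalize ringKrullDim (B ⧸ (maximalIdeal A).map (algebraMap A B)) = dF at *
  have hA : dA ≠ ⊥ := by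
    rintro rfl
    simp at haA
  have hF' : dF ≠ ⊥ := by
    rintro rfl
    simp at hfF
  lift dA to ℕ∞ using hA
  lift dF to ℕ∞ using hF'
  norm_cast at haA hfF hsum ⊢
  have hfin : dA + dF ≠ ⊤ := (hsum.trans_lt (by exact_mod_cast ENat.natCast_lt_top _)).ne
  lift dA to ℕ using fun h ↦ hfin (by simp [h])
  lift dF to ℕ using fun h ↦ hfin (by simp [h])
  norm_cast at haA hfF hsum ⊢
  refine ⟨by omega, le_trans (b := ((1 + f : ℕ) : ℕ∞)) (by norm_cast; omega) ?_⟩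
  push_cast
  gcongr
end

section
/- Let u: A → B be a faithfully flat morphism of noetherian rings and k a natural number. If B has property (C_k), then A has property (C_k). -/
open IsLocalRing

open CategoryTheory CategoryTheory.Abelian Limits RingTheory.Sequence

universe u w

section

variable {A : Type u} {B : Type w} [CommRing A] [CommRing B] [Algebra A B]

/-- Along a faithfully flat base change `f : M → N`, if `N` has no nonzero elements killed by
`I B`, then `M` has no nonzero elements killed by `I`. -/
lemma subsingleton_quotient_linearMap_of_isBaseChange [Module.FaithfullyFlat A B]
    {M N : Type*} [AddCommGroup M] [Module A M] [AddCommGroup N] [Module A N] [Module B N]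
    [IsScalarTower A B N] {f : M →ₗ[A] N} (hf : IsBaseChange B f) (I : Ideal A)
    [Subsingleton ((B ⧸ I.map (algebraMap A B)) →ₗ[B] N)] :
    Subsingleton ((A ⧸ I) →ₗ[A] M) := by
  have hinj : Function.Injective f := by
    have h : ⇑f = hf.equiv ∘ TensorProduct.mk A B M 1 := by
      ext m
      simp [hf.equiv_tmul]
    rw [h]
    exact hf.equiv.injective.comp (Module.FaithfullyFlat.tensorProduct_mk_injective M)
  refine subsingleton_of_forall_eq 0 fun g ↦ Submodule.linearMap_qext _ (LinearMap.ext_ring ?_)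
  have hg : ∀ a ∈ I, a • g (Submodule.Quotient.mk 1) = 0 := fun a ha ↦ by
    rw [← map_smul, ← Submodule.Quotient.mk_smul, smul_eq_mul, mul_one,
      (Submodule.Quotient.mk_eq_zero I).mpr ha, map_zero]
  let h : (B ⧸ I.map (algebraMap A B)) →ₗ[B] N :=
    Submodule.liftQ _ (LinearMap.toSpanSingleton B N (f (g (Submodule.Quotient.mk 1)))) <|
      Ideal.map_le_iff_le_comap.mpr fun a ha ↦ by
        rw [Ideal.mem_comap, LinearMap.mem_ker, LinearMap.toSpanSingleton_apply, algebraMap_smul,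
          ← map_smul, hg a ha, map_zero]
  have h1 : h (Submodule.Quotient.mk 1) = 0 := by
    rw [Subsingleton.elim h 0, LinearMap.zero_apply]
  apply hinj
  change f (g (Submodule.Quotient.mk 1)) = f 0
  simpa only [h, map_zero, Submodule.liftQ_apply, LinearMap.toSpanSingleton_apply, one_smul]
    using h1

/-- If `N` is a faithfully flat base change of `M` and `Ext B (B ⧸ I B) N i` vanishes for `i < n`,
then `I` contains a weakly `M`-regular sequence of length `n`. -/
lemma exists_isWeaklyRegular_of_subsingleton_ext_baseChange [IsNoetherianRing A]
    [Module.FaithfullyFlat A B] {M : Type*} {N : Type w}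
    [AddCommGroup M] [Module A M] [Module.Finite A M]
    [AddCommGroup N] [Module A N] [Module B N] [IsScalarTower A B N]
    {f : M →ₗ[A] N} (hf : IsBaseChange B f) (I : Ideal A) (n : ℕ)
    (hext : ∀ i < n, Subsingleton
      (Ext (ModuleCat.of B (B ⧸ I.map (algebraMap A B))) (ModuleCat.of B N) i)) :
    ∃ rs : List A, rs.length = n ∧ (∀ r ∈ rs, r ∈ I) ∧ IsWeaklyRegular M rs := by
  induction n generalizing M N with
  | zero => exact ⟨[], by simp⟩
  | succ n ih =>
    have : Subsingleton ((B ⧸ I.map (algebraMap A B)) →ₗ[B] N) :=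
      (Ext.addEquiv₀.trans ModuleCat.homAddEquiv).symm.subsingleton_congr.mpr
        (hext 0 n.zero_lt_succ)
    obtain ⟨x, hxI, hx⟩ := IsSMulRegular.subsingleton_linearMap_iff.mp
      (subsingleton_quotient_linearMap_of_isBaseChange hf I)
    rw [Ideal.annihilator_quotient] at hxI
    have hxN : IsSMulRegular N (algebraMap A B x) := hx.of_flat_of_isBaseChange hf
    let e := (QuotSMulTop.algebraMapTensorEquivTensorQuotSMulTop x M B).symm ≪≫ₗ
      QuotSMulTop.congr ((algebraMap A B) x) hf.equiv
    have hg : IsBaseChange B <|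
        e.toLinearMap.restrictScalars A ∘ₗ TensorProduct.mk A B (QuotSMulTop x M) 1 :=
      IsBaseChange.of_equiv e (fun _ ↦ by simp)
    obtain ⟨rs, hlen, hmem, hreg⟩ := ih hg fun i hi ↦ by
      have zero1 := AddCommGrpCat.isZero_of_iff_subsingleton.mpr (hext i (by omega))
      have zero2 := AddCommGrpCat.isZero_of_iff_subsingleton.mpr (hext (i + 1) (by omega))
      have hxN' : IsSMulRegular (ModuleCat.of B N) (algebraMap A B x) := hxN
      exact AddCommGrpCat.subsingleton_of_isZero <| ShortComplex.Exact.isZero_of_both_zeros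
        (Ext.covariant_sequence_exact₃' _ hxN'.smulShortComplex_shortExact i (i + 1) rfl)
        (zero1.eq_zero_of_src _) (zero2.eq_zero_of_tgt _)
    exact ⟨x :: rs, by simp [hlen], by simpa [hxI] using hmem, .cons hx hreg⟩

/-- Depth does not increase when descending a flat local homomorphism of noetherian local rings
whose closed fiber is zero-dimensional. -/
lemma ringDepth_le_of_faithfullyFlat [IsNoetherianRing A] [IsNoetherianRing B]
    [IsLocalRing A] [IsLocalRing B] [Module.FaithfullyFlat A B]
    (hrad : maximalIdeal B ≤ ((maximalIdeal A).map (algebraMap A B)).radical) :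
    ringDepth B ≤ ringDepth A := by
  refine sSup_le ?_
  rintro _ ⟨ss, rfl, hss, hreg⟩
  obtain ⟨rs, hlen, hmem, hrs⟩ := exists_isWeaklyRegular_of_subsingleton_ext_baseChange
    (IsBaseChange.linearMap A B) (maximalIdeal A) ss.length <|
    ModuleCat.subsingleton_ext_of_exists_isRegular (maximalIdeal B)
      (ModuleCat.of B (B ⧸ (maximalIdeal A).map (algebraMap A B)))
      (by
        rw [Module.support_eq_zeroLocus, Ideal.annihilator_quotient]
        exact (PrimeSpectrum.zeroLocus_subset_zeroLocus_iff _ _).mpr hrad)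
      (ModuleCat.of B B)
      (by simpa using (maximalIdeal.isMaximal B).ne_top.lt_top) ss hss hreg
  exact le_sSup ⟨rs, by rw [hlen], hmem,
    (IsLocalRing.isRegular_iff_isWeaklyRegular_of_subset_maximalIdeal hmem).mpr hrs⟩

/-- Along a faithfully flat ring map every prime `P` is the contraction of a minimal prime
of its extension. -/
lemma Ideal.exists_mem_minimalPrimes_map_liesOver [Module.FaithfullyFlat A B]
    (P : Ideal A) [P.IsPrime] :
    ∃ Q ∈ (P.map (algebraMap A B)).minimalPrimes, Q.LiesOver P := by
  obtain ⟨Q, hQ, hQP⟩ := Ideal.exists_minimalPrimes_comap_eq (I := P.map (algebraMap A B))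
    (algebraMap A B) P (by
      rw [Ideal.comap_map_eq_self_of_faithfullyFlat, Ideal.minimalPrimes_eq_subsingleton_self]
      rfl)
  exact ⟨Q, hQ, ⟨hQP.symm⟩⟩

lemma localDepth_le_of_mem_minimalPrimes_map [IsNoetherianRing A] [IsNoetherianRing B]
    [Module.Flat A B] (P : Ideal A) [P.IsPrime] (Q : Ideal B) [Q.IsPrime] [Q.LiesOver P]
    (hQ : Q ∈ (P.map (algebraMap A B)).minimalPrimes) :
    localDepth Q ≤ localDepth P := by
  let := Localization.AtPrime.algebraOfLiesOver P Q
  have : IsLocalHom (algebraMap (Localization.AtPrime P) (Localization.AtPrime Q)) := by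
    rw [RingHom.algebraMap_toAlgebra]
    exact Localization.isLocalHom_localRingHom P Q (algebraMap A B) Ideal.LiesOver.over
  have : Module.FaithfullyFlat (Localization.AtPrime P) (Localization.AtPrime Q) :=
    Module.FaithfullyFlat.of_flat_of_isLocalHom
  have : IsNoetherianRing (Localization.AtPrime P) :=
    IsLocalization.isNoetherianRing P.primeCompl _ inferInstance
  have : IsNoetherianRing (Localization.AtPrime Q) :=
    IsLocalization.isNoetherianRing Q.primeCompl _ inferInstance
  apply ringDepth_le_of_faithfullyFlat
  rw [← Localization.AtPrime.map_eq_maximalIdeal, ← Localization.AtPrime.map_eq_maximalIdeal,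
    ← IsLocalization.AtPrime.radical_map_of_mem_minimalPrimes (Localization.AtPrime Q) Q _ hQ,
    Ideal.map_map, Ideal.map_map, ← IsScalarTower.algebraMap_eq, ← IsScalarTower.algebraMap_eq]

lemma primeHeight_le_of_liesOver [IsNoetherianRing A] [IsNoetherianRing B] [Module.Flat A B]
    (P : Ideal A) [P.IsPrime] (Q : Ideal B) [Q.IsPrime] [Q.LiesOver P] :
    primeHeight P ≤ primeHeight Q := by
  rw [primeHeight, primeHeight, ← PrimeSpectrum.height_eq_orderHeight,
    ← PrimeSpectrum.height_eq_orderHeight]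
  exact (Ideal.height_eq_height_add_of_liesOver_of_hasGoingDown P Q).symm ▸ le_self_add

end


theorem condC_descends_along_faithfully_flat {A B : Type*} [CommRing A] [CommRing B]
    [IsNoetherianRing A] [IsNoetherianRing B] [Algebra A B] [Module.FaithfullyFlat A B]
    (k : ℕ) (hB : CondC k B) : CondC k A := by
  intro P _
  obtain ⟨Q, hQ, _⟩ := Ideal.exists_mem_minimalPrimes_map_liesOver (B := B) P
  have : Q.IsPrime := hQ.isPrime
  calc min (primeHeight P) (k : ℕ∞) ≤ min (primeHeight Q) k :=
        min_le_min_right _ (primeHeight_le_of_liesOver P Q)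
    _ ≤ 1 + localDepth Q := hB Q
    _ ≤ 1 + localDepth P := by
        gcongr
        exact localDepth_le_of_mem_minimalPrimes_map P Q hQ
end
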